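/- arXiv:1312.2201 — 2 statements merged into one kernel-verified Lean document; each statement's English description precedes it below -/
import Mathlib

section
/- Let δ(j) = log Q(j,ℤ₊), δ⁺ = max(δ,0), and suppose δ := ∑_{j=0}^∞ δ⁺(j) < ∞. Then for every i ∈ ℤ₊, f(i) ≤ sup_{j∈ℤ₊} E_i e^{δ ℓ(j)} (possibly infinite). If in addition P_i{Xₙ > N for all n ≥ 0} → 1 as i → ∞ for every fixed N, and sup_{i∈ℤ₊} E_i e^{δ ℓ(i)} < ∞, then limsup_{i→∞} f(i) ≤ 1. -/
open MeasureTheory Filter Topology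
open scoped ENNReal NNReal

structure MC where
  μ : ℕ → Measure (ℕ → ℕ)
  prob : ∀ i, IsProbabilityMeasure (μ i)
  start : ∀ i, μ i {ω | ω 0 = i} = 1
  P : ℕ → ℕ → ℝ≥0∞
  P_sum : ∀ i, ∑' j, P i j = 1
  markov : ∀ i, (μ i).map (fun ω n => ω (n + 1)) = Measure.sum fun j => P i j • μ j

noncomputable def qt (Q : ℕ → ℕ → ℝ≥0∞) (i : ℕ) : ℝ≥0∞ := ∑' j, Q i j

noncomputable def fQ (Q : ℕ → ℕ → ℝ≥0∞) (X : MC) (i : ℕ) : ℝ≥0∞ :=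
  ∫⁻ ω, ∏' n, qt Q (ω n) ∂(X.μ i)

def condC (Q : ℕ → ℕ → ℝ≥0∞) (X : MC) : Prop :=
  ∀ i, (∫⁻ ω, ∏' n, max (qt Q (ω n)) 1 ∂(X.μ i)) < ∞

noncomputable def Qpow (Q : ℕ → ℕ → ℝ≥0∞) : ℕ → ℕ → ℕ → ℝ≥0∞
  | 0 => fun i j => if i = j then 1 else 0
  | n + 1 => fun i j => ∑' k, Q i k * Qpow Q n k j

def Irred (Q : ℕ → ℕ → ℝ≥0∞) : Prop := ∀ i j, ∃ n, 0 < Qpow Q n i j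

noncomputable def locTime (j : ℕ) (ω : ℕ → ℕ) : ℝ≥0∞ := ∑' n, if ω n = j then 1 else 0

noncomputable def locExp (γ : ℝ) (j : ℕ) (ω : ℕ → ℕ) : ℝ≥0∞ :=
  ∏' n, if ω n = j then ENNReal.ofReal (Real.exp γ) else 1

noncomputable def deltaQ (Q : ℕ → ℕ → ℝ≥0∞) (j : ℕ) : ℝ := Real.log (qt Q j).toReal

noncomputable def jumpP (X : MC) (i : ℕ) (j : ℤ) : ℝ≥0∞ :=
  if 0 ≤ (i : ℤ) + j then X.P i ((i : ℤ) + j).toNat else 0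

lemma tprod_eq_sup (f : ℕ → ℝ≥0∞) (hf : ∀ n, 1 ≤ f n) :
    HasProd f (⨆ s : Finset ℕ, ∏ n ∈ s, f n) := by
  have hm : Monotone (fun s : Finset ℕ => ∏ n ∈ s, f n) := by
    intro s t hst
    exact Finset.prod_le_prod_of_subset_of_one_le' hst (fun i _ _ => hf i)
  simpa [HasProd] using tendsto_atTop_iSup hm

lemma tprod_eq_supN (f : ℕ → ℝ≥0∞) (hf : ∀ n, 1 ≤ f n) :
    ∏' n, f n = ⨆ N : ℕ, ∏ n ∈ Finset.range N, f n := by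
  have h1 := (tprod_eq_sup f hf).multipliable.hasProd.tendsto_prod_nat
  have hm : Monotone (fun N : ℕ => ∏ n ∈ Finset.range N, f n) := by
    intro s t hst
    exact Finset.prod_le_prod_of_subset_of_one_le' (Finset.range_mono hst) (fun i _ _ => hf i)
  exact tendsto_nhds_unique h1 (tendsto_atTop_iSup hm)

lemma one_le_tprodN (f : ℕ → ℝ≥0∞) (hf : ∀ n, 1 ≤ f n) : 1 ≤ ∏' n, f n := by
  rw [tprod_eq_supN f hf]
  exact le_iSup_of_le 0 (by simp)

lemma tprod_le_max (f : ℕ → ℝ≥0∞) : ∏' n, f n ≤ ∏' n, max (f n) 1 := by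
  by_cases h : Multipliable f
  · have h2 := (tprod_eq_sup (fun n => max (f n) 1) (fun n => le_max_right _ _))
    rw [h2.tprod_eq]
    have h3 := h.hasProd
    simp only [HasProd, SummationFilter.unconditional_filter] at h3
    refine le_of_tendsto' h3 fun s => ?_
    exact le_trans (Finset.prod_le_prod' fun i _ => le_max_left _ _)
      (le_iSup (fun s : Finset ℕ => ∏ n ∈ s, max (f n) 1) s)
  · rw [tprod_eq_one_of_not_multipliable h]
    exact one_le_tprodN _ (fun n => le_max_right _ _)

lemma locExp_fac {γ : ℝ} (hγ : 0 ≤ γ) (j k : ℕ) :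
    (1 : ℝ≥0∞) ≤ if k = j then ENNReal.ofReal (Real.exp γ) else 1 := by
  split_ifs
  · rw [← ENNReal.ofReal_one]
    exact ENNReal.ofReal_le_ofReal (Real.one_le_exp hγ)
  · exact le_rfl

lemma locExp_eq {γ : ℝ} (hγ : 0 ≤ γ) (j : ℕ) (ω : ℕ → ℕ) :
    locExp γ j ω = ⨆ N : ℕ, ∏ n ∈ Finset.range N,
      if ω n = j then ENNReal.ofReal (Real.exp γ) else 1 :=
  tprod_eq_supN _ (fun n => locExp_fac hγ j (ω n))

lemma locExp_meas {γ : ℝ} (hγ : 0 ≤ γ) (j : ℕ) : Measurable (locExp γ j) := by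
  have : locExp γ j = fun ω => ⨆ N : ℕ, ∏ n ∈ Finset.range N,
      if ω n = j then ENNReal.ofReal (Real.exp γ) else 1 := funext fun ω => locExp_eq hγ j ω
  rw [this]
  refine Measurable.iSup fun N => Finset.measurable_fun_prod _ fun n _ => ?_
  exact (measurable_of_countable (fun k : ℕ => if k = j then ENNReal.ofReal (Real.exp γ) else 1)).comp
    (measurable_pi_apply n)

lemma locExp_shift {γ : ℝ} (hγ : 0 ≤ γ) (j : ℕ) (ω : ℕ → ℕ) (h0 : ω 0 ≠ j) :
    locExp γ j ω = locExp γ j (fun n => ω (n + 1)) := by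
  rw [locExp_eq hγ, locExp_eq hγ]
  apply le_antisymm
  · refine iSup_le fun N => ?_
    cases N with
    | zero => exact le_iSup_of_le 0 (by simp)
    | succ N =>
      refine le_iSup_of_le N ?_
      rw [Finset.prod_range_succ']
      simp [h0]
  · refine iSup_le fun N => le_iSup_of_le (N + 1) ?_
    rw [Finset.prod_range_succ']
    simp [h0]

lemma jensen_pt (w d : ℕ → ℝ) (D : ℝ) (hw : ∀ j, 0 ≤ w j) (hws : HasSum w 1)
    (hD : 0 ≤ D) (hwd : ∀ j, w j * D = d j) (ω : ℕ → ℕ) (N : ℕ) :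
    ENNReal.ofReal (Real.exp (∑ n ∈ Finset.range N, d (ω n))) ≤
      ∑' j, ENNReal.ofReal (w j) * locExp D j ω := by
  set m := ∑ n ∈ Finset.range N, d (ω n) with hm
  let c : ℕ → ℝ := fun j => ∑ n ∈ Finset.range N, if ω n = j then D else 0
  have hc : HasSum (fun j => w j * c j) m := by
    have h1 : HasSum (fun j => ∑ n ∈ Finset.range N, if j = ω n then d (ω n) else 0) m :=
      hasSum_sum fun n _ => hasSum_ite_eq (ω n) (d (ω n))
    convert h1 using 2 with j
    simp only [c, Finset.mul_sum]
    refine Finset.sum_congr rfl fun n _ => ?_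
    by_cases h : ω n = j
    · subst h; simp [hwd]
    · simp [h, Ne.symm h]
  have hs : HasSum (fun j => Real.exp m * (w j * (1 - m) + w j * c j)) (Real.exp m) := by
    have := ((hws.mul_right (1 - m)).add hc).mul_left (Real.exp m)
    have e : Real.exp m * (1 * (1 - m) + m) = Real.exp m := by ring
    rwa [e] at this
  have hle : ∀ j, ENNReal.ofReal (Real.exp m * (w j * (1 - m) + w j * c j)) ≤
      ENNReal.ofReal (w j) * locExp D j ω := by
    intro j
    have e1 : Real.exp m * (w j * (1 - m) + w j * c j) ≤ w j * Real.exp (c j) := by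
      have h1 := Real.add_one_le_exp (c j - m)
      have h2 : Real.exp (c j) = Real.exp m * Real.exp (c j - m) := by
        rw [← Real.exp_add]; ring_nf
      have h3 : 0 ≤ w j * Real.exp m := mul_nonneg (hw j) (Real.exp_pos _).le
      rw [h2]
      nlinarith [mul_le_mul_of_nonneg_left h1 h3]
    refine (ENNReal.ofReal_le_ofReal e1).trans ?_
    rw [ENNReal.ofReal_mul (hw j)]
    gcongr
    rw [locExp_eq hD]
    refine le_iSup_of_le N ?_
    simp only [c]
    rw [Real.exp_sum, ENNReal.ofReal_prod_of_nonneg (fun _ _ => (Real.exp_pos _).le)]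
    refine Finset.prod_le_prod' fun n _ => ?_
    split_ifs <;> simp
  have ht : Tendsto (fun s : Finset ℕ => ENNReal.ofReal
      (∑ j ∈ s, Real.exp m * (w j * (1 - m) + w j * c j))) atTop
      (𝓝 (ENNReal.ofReal (Real.exp m))) := by
    have := hs
    simp only [HasSum, SummationFilter.unconditional_filter] at this
    exact (ENNReal.continuous_ofReal.tendsto _).comp this
  refine le_of_tendsto' ht fun s => ?_
  refine le_trans ?_ (ENNReal.sum_le_tsum s)
  refine le_trans ?_ (Finset.sum_le_sum fun j _ => hle j)
  exact Finset.le_sum_of_subadditive _ ENNReal.ofReal_zero.le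
    (fun _ _ => ENNReal.ofReal_add_le) _ _

lemma max_qt (Q : ℕ → ℕ → ℝ≥0∞) (hpos : ∀ i, 0 < qt Q i) (hfin : ∀ i, qt Q i < ∞) (k : ℕ) :
    max (qt Q k) 1 = ENNReal.ofReal (Real.exp (max (deltaQ Q k) 0)) := by
  have h := ENNReal.toReal_pos (hpos k).ne' (hfin k).ne
  rw [Real.exp_monotone.map_max, deltaQ, Real.exp_log h, Real.exp_zero,
    ENNReal.ofReal_mono.map_max, ENNReal.ofReal_toReal (hfin k).ne, ENNReal.ofReal_one]

def firstHit (j n : ℕ) : Set (ℕ → ℕ) := {ω | ω n = j ∧ ∀ m < n, ω m ≠ j}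

lemma firstHit_meas (j n : ℕ) : MeasurableSet (firstHit j n) := by
  have : firstHit j n = (fun ω : ℕ → ℕ => ω n) ⁻¹' {j} ∩
      ⋂ m : ℕ, ⋂ _ : m < n, (fun ω : ℕ → ℕ => ω m) ⁻¹' {j}ᶜ := by
    ext ω; simp [firstHit]
  rw [this]
  exact (measurable_pi_apply n (measurableSet_singleton j)).inter
    (MeasurableSet.iInter fun m => MeasurableSet.iInter fun _ =>
      measurable_pi_apply m (measurableSet_singleton j).compl)

lemma firstHit_succ (j n : ℕ) (ω : ℕ → ℕ) (h0 : ω 0 ≠ j) :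
    ω ∈ firstHit j (n + 1) ↔ (fun n => ω (n + 1)) ∈ firstHit j n := by
  simp only [firstHit, Set.mem_setOf_eq]
  refine and_congr_right fun _ => ⟨fun h m hm => h (m + 1) (by omega), fun h m hm => ?_⟩
  cases m with
  | zero => exact h0
  | succ m => exact h m (by omega)

lemma MC.ae_start (X : MC) (i : ℕ) : ∀ᵐ ω ∂(X.μ i), ω 0 = i := by
  haveI := X.prob i
  have hm : MeasurableSet {ω : ℕ → ℕ | ω 0 = i} :=
    measurable_pi_apply (X := fun _ : ℕ => ℕ) 0 (measurableSet_singleton i)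
  exact (mem_ae_iff_prob_eq_one hm).2 (X.start i)

lemma MC.lintegral_shift (X : MC) (i : ℕ) (F : (ℕ → ℕ) → ℝ≥0∞) (hF : Measurable F) :
    ∫⁻ ω, F (fun n => ω (n + 1)) ∂(X.μ i) = ∑' k, X.P i k * ∫⁻ ω, F ω ∂(X.μ k) := by
  have hs : Measurable (fun (ω : ℕ → ℕ) (n : ℕ) => ω (n + 1)) :=
    measurable_pi_lambda _ fun n => measurable_pi_apply (n + 1)
  rw [← lintegral_map hF hs, X.markov i, lintegral_sum_measure]
  simp [lintegral_smul_measure]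

lemma firstHit_int (X : MC) {γ : ℝ} (hγ : 0 ≤ γ) (j n : ℕ) : ∀ i,
    ∫⁻ ω, (firstHit j n).indicator (locExp γ j) ω ∂(X.μ i) =
      (∫⁻ ω, locExp γ j ω ∂(X.μ j)) * ∫⁻ ω, (firstHit j n).indicator 1 ω ∂(X.μ i) := by
  induction n with
  | zero =>
    intro i
    haveI := X.prob i
    by_cases hij : i = j
    · subst hij
      have h1 : ∀ᵐ ω ∂(X.μ i), (firstHit i 0).indicator (locExp γ i) ω = locExp γ i ω := by
        filter_upwards [X.ae_start i] with ω hω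
        simp [firstHit, hω]
      have h2 : ∀ᵐ ω ∂(X.μ i), (firstHit i 0).indicator (1 : (ℕ → ℕ) → ℝ≥0∞) ω = 1 := by
        filter_upwards [X.ae_start i] with ω hω
        simp [firstHit, hω]
      rw [lintegral_congr_ae h1, lintegral_congr_ae h2]
      simp
    · have h1 : ∀ᵐ ω ∂(X.μ i), (firstHit j 0).indicator (locExp γ j) ω = 0 := by
        filter_upwards [X.ae_start i] with ω hω
        simp [firstHit, hω, hij]
      have h2 : ∀ᵐ ω ∂(X.μ i), (firstHit j 0).indicator (1 : (ℕ → ℕ) → ℝ≥0∞) ω = 0 := by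
        filter_upwards [X.ae_start i] with ω hω
        simp [firstHit, hω, hij]
      rw [lintegral_congr_ae h1, lintegral_congr_ae h2]
      simp
  | succ n ih =>
    intro i
    by_cases hij : i = j
    · have hn : ∀ᵐ ω ∂(X.μ i), ω ∉ firstHit j (n + 1) := by
        filter_upwards [X.ae_start i] with ω hω h
        exact h.2 0 (by omega) (hω.trans hij)
      have h1 : ∀ᵐ ω ∂(X.μ i), (firstHit j (n + 1)).indicator (locExp γ j) ω = 0 := by
        filter_upwards [hn] with ω hω
        simp [hω]
      have h2 : ∀ᵐ ω ∂(X.μ i),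
          (firstHit j (n + 1)).indicator (1 : (ℕ → ℕ) → ℝ≥0∞) ω = 0 := by
        filter_upwards [hn] with ω hω
        simp [hω]
      rw [lintegral_congr_ae h1, lintegral_congr_ae h2]
      simp
    · have h1 : ∀ᵐ ω ∂(X.μ i), (firstHit j (n + 1)).indicator (locExp γ j) ω =
          (firstHit j n).indicator (locExp γ j) (fun n => ω (n + 1)) := by
        filter_upwards [X.ae_start i] with ω hω
        have h0 : ω 0 ≠ j := by rw [hω]; exact hij
        by_cases h : ω ∈ firstHit j (n + 1)
        · rw [Set.indicator_of_mem h, Set.indicator_of_mem ((firstHit_succ j n ω h0).1 h),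
            locExp_shift hγ j ω h0]
        · rw [Set.indicator_of_notMem h,
            Set.indicator_of_notMem (fun h' => h ((firstHit_succ j n ω h0).2 h'))]
      have h2 : ∀ᵐ ω ∂(X.μ i), (firstHit j (n + 1)).indicator (1 : (ℕ → ℕ) → ℝ≥0∞) ω =
          (firstHit j n).indicator 1 (fun n => ω (n + 1)) := by
        filter_upwards [X.ae_start i] with ω hω
        have h0 : ω 0 ≠ j := by rw [hω]; exact hij
        by_cases h : ω ∈ firstHit j (n + 1)
        · rw [Set.indicator_of_mem h, Set.indicator_of_mem ((firstHit_succ j n ω h0).1 h)]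
          rfl
        · rw [Set.indicator_of_notMem h,
            Set.indicator_of_notMem (fun h' => h ((firstHit_succ j n ω h0).2 h'))]
      rw [lintegral_congr_ae h1, lintegral_congr_ae h2,
        X.lintegral_shift i _ ((locExp_meas hγ j).indicator (firstHit_meas j n)),
        X.lintegral_shift i _ (measurable_one.indicator (firstHit_meas j n)),
        ← ENNReal.tsum_mul_left]
      refine tsum_congr fun k => ?_
      rw [ih k]
      ring

lemma firstHit_disj (j : ℕ) : Pairwise (Function.onFun Disjoint (firstHit j)) := by
  intro a b hab
  rw [Function.onFun, Set.disjoint_left]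
  intro ω ha hb
  rcases lt_or_gt_of_ne hab with h | h
  · exact hb.2 a h ha.1
  · exact ha.2 b h hb.1

lemma locExp_bound (X : MC) {γ : ℝ} (hγ : 0 ≤ γ) (i j : ℕ) :
    ∫⁻ ω, locExp γ j ω ∂(X.μ i) ≤
      1 + (∫⁻ ω, locExp γ j ω ∂(X.μ j)) * (1 - X.μ i {ω | ∀ n, j < ω n}) := by
  haveI := X.prob i
  set H : Set (ℕ → ℕ) := ⋃ n, firstHit j n with hH
  have hHm : MeasurableSet H := MeasurableSet.iUnion fun n => firstHit_meas j n
  have hHc : ∀ ω, ω ∉ H → ∀ n, ω n ≠ j := by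
    intro ω hω
    by_contra! hex
    classical
    apply hω
    exact Set.mem_iUnion.2 ⟨Nat.find hex, Nat.find_spec hex, fun m hm => Nat.find_min hex hm⟩
  have hHi : ∫⁻ ω in H, locExp γ j ω ∂(X.μ i) =
      (∫⁻ ω, locExp γ j ω ∂(X.μ j)) * X.μ i H := by
    rw [hH, lintegral_iUnion (firstHit_meas j) (firstHit_disj j),
      measure_iUnion (firstHit_disj j) (firstHit_meas j), ← ENNReal.tsum_mul_left]
    refine tsum_congr fun n => ?_
    rw [← lintegral_indicator (firstHit_meas j n), firstHit_int X hγ j n i,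
      lintegral_indicator_one (firstHit_meas j n)]
  have hHn : ∫⁻ ω in Hᶜ, locExp γ j ω ∂(X.μ i) ≤ 1 := by
    have : ∫⁻ ω in Hᶜ, locExp γ j ω ∂(X.μ i) = ∫⁻ ω in Hᶜ, 1 ∂(X.μ i) := by
      refine setLIntegral_congr_fun hHm.compl fun ω hω => ?_
      simp [locExp, hHc ω hω]
    rw [this, setLIntegral_one]
    exact prob_le_one
  rw [← lintegral_add_compl _ hHm, hHi, add_comm]
  gcongr
  have : H ⊆ {ω | ∀ n, j < ω n}ᶜ := by
    intro ω hω h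
    obtain ⟨n, hn⟩ := Set.mem_iUnion.1 hω
    exact absurd (h n) (by simp [hn.1])
  have hm : MeasurableSet {ω : ℕ → ℕ | ∀ n, j < ω n} := by
    have : {ω : ℕ → ℕ | ∀ n, j < ω n} = ⋂ n, (fun ω : ℕ → ℕ => ω n) ⁻¹' (Set.Ioi j) := by
      ext; simp
    rw [this]
    exact MeasurableSet.iInter fun n => measurable_pi_apply n measurableSet_Ioi
  exact (measure_mono this).trans (prob_compl_eq_one_sub hm).le

lemma exists_weights (d : ℕ → ℝ) (hd : ∀ j, 0 ≤ d j) (hs : Summable d) :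
    ∃ w : ℕ → ℝ, (∀ j, 0 ≤ w j) ∧ HasSum w 1 ∧ ∀ j, w j * (∑' j, d j) = d j := by
  by_cases h : ∑' j, d j = 0
  · have h0 : ∀ j, d j = 0 := by
      have := (hasSum_zero_iff_of_nonneg hd).1 (h ▸ hs.hasSum)
      exact fun j => congrFun this j
    refine ⟨fun j => if j = 0 then 1 else 0, fun j => ?_, hasSum_ite_eq 0 1, fun j => ?_⟩
    · show (0 : ℝ) ≤ if j = 0 then 1 else 0
      split_ifs <;> norm_num
    · rw [h, h0]; simp
  · refine ⟨fun j => d j / ∑' j, d j, fun j => div_nonneg (hd j) (tsum_nonneg hd), ?_, fun j => ?_⟩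
    · have := hs.hasSum.div_const (∑' j, d j)
      rwa [div_self h] at this
    · field_simp

theorem stmt3 (Q : ℕ → ℕ → ℝ≥0∞) (X : MC)
    (hpos : ∀ i, 0 < qt Q i) (hfin : ∀ i, qt Q i < ∞)
    (hirr : Irred Q)
    (hP : ∀ i j, X.P i j = Q i j / qt Q i)
    (hδp : Summable fun j => max (deltaQ Q j) 0) :
    (∀ i, fQ Q X i ≤ ⨆ j, ∫⁻ ω, locExp (∑' j', max (deltaQ Q j') 0) j ω ∂(X.μ i)) ∧
    ((∀ N : ℕ, Tendsto (fun i => X.μ i {ω | ∀ n, N < ω n}) atTop (𝓝 1)) →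
      (⨆ i, ∫⁻ ω, locExp (∑' j', max (deltaQ Q j') 0) i ω ∂(X.μ i)) < ∞ →
      Filter.atTop.limsup (fun i => fQ Q X i) ≤ 1) := by
  set d : ℕ → ℝ := fun j => max (deltaQ Q j) 0 with hd
  have hd0 : ∀ j, 0 ≤ d j := fun j => le_max_right _ _
  obtain ⟨w, hw0, hws, hwd⟩ := exists_weights d hd0 hδp
  set D : ℝ := ∑' j, d j with hDdef
  have hD : 0 ≤ D := tsum_nonneg hd0
  have hW : ∑' j, ENNReal.ofReal (w j) = 1 := by
    rw [← ENNReal.ofReal_tsum_of_nonneg hw0 hws.summable, hws.tsum_eq, ENNReal.ofReal_one]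
  have key : ∀ i, fQ Q X i ≤
      ∑' j, ENNReal.ofReal (w j) * ∫⁻ ω, locExp D j ω ∂(X.μ i) := by
    intro i
    have h1 : fQ Q X i ≤ ∫⁻ ω, ∑' j, ENNReal.ofReal (w j) * locExp D j ω ∂(X.μ i) := by
      refine lintegral_mono fun ω => ?_
      refine (tprod_le_max _).trans ?_
      rw [tprod_eq_supN _ (fun n => le_max_right _ _)]
      refine iSup_le fun N => ?_
      refine le_trans (le_of_eq ?_) (jensen_pt w d D hw0 hws hD hwd ω N)
      rw [Real.exp_sum, ENNReal.ofReal_prod_of_nonneg (fun _ _ => (Real.exp_pos _).le)]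
      exact Finset.prod_congr rfl fun n _ => max_qt Q hpos hfin (ω n)
    refine h1.trans (le_of_eq ?_)
    rw [lintegral_tsum fun j => ((locExp_meas hD j).const_mul _).aemeasurable]
    exact tsum_congr fun j => lintegral_const_mul _ (locExp_meas hD j)
  refine ⟨fun i => ?_, fun htr hsup => ?_⟩
  · refine (key i).trans ?_
    calc ∑' j, ENNReal.ofReal (w j) * ∫⁻ ω, locExp D j ω ∂(X.μ i)
        ≤ ∑' j, ENNReal.ofReal (w j) * ⨆ j, ∫⁻ ω, locExp D j ω ∂(X.μ i) :=
          ENNReal.tsum_le_tsum fun j => mul_le_mul_right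
            (le_iSup (fun j => ∫⁻ ω, locExp D j ω ∂(X.μ i)) j) _
      _ = ⨆ j, ∫⁻ ω, locExp D j ω ∂(X.μ i) := by rw [ENNReal.tsum_mul_right, hW, one_mul]
  · set M := ⨆ i, ∫⁻ ω, locExp D i ω ∂(X.μ i) with hM
    have hb : ∀ i, fQ Q X i ≤
        1 + M * ∑' j, ENNReal.ofReal (w j) * (1 - X.μ i {ω | ∀ n, j < ω n}) := by
      intro i
      refine (key i).trans ?_
      calc ∑' j, ENNReal.ofReal (w j) * ∫⁻ ω, locExp D j ω ∂(X.μ i)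
          ≤ ∑' j, (ENNReal.ofReal (w j) +
              M * (ENNReal.ofReal (w j) * (1 - X.μ i {ω | ∀ n, j < ω n}))) := by
            refine ENNReal.tsum_le_tsum fun j => ?_
            have h1 : ∫⁻ ω, locExp D j ω ∂(X.μ i) ≤
                1 + M * (1 - X.μ i {ω | ∀ n, j < ω n}) := by
              refine (locExp_bound X hD i j).trans ?_
              gcongr
              exact le_iSup (fun j => ∫⁻ ω, locExp D j ω ∂(X.μ j)) j
            calc _ ≤ ENNReal.ofReal (w j) * (1 + M * (1 - X.μ i {ω | ∀ n, j < ω n})) := by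
                  gcongr
              _ = _ := by ring
        _ = _ := by rw [ENNReal.tsum_add, hW, ENNReal.tsum_mul_left]
    have ht : Tendsto (fun i => ∑' j, ENNReal.ofReal (w j) * (1 - X.μ i {ω | ∀ n, j < ω n}))
        atTop (𝓝 0) := by
      have h1 := tendsto_lintegral_of_dominated_convergence (μ := Measure.count (α := ℕ))
        (F := fun i j => ENNReal.ofReal (w j) * (1 - X.μ i {ω | ∀ n, j < ω n}))
        (f := fun _ => 0) (fun j => ENNReal.ofReal (w j))
        (fun i => measurable_of_countable _)
        (fun i => ae_of_all _ fun j => mul_le_of_le_one_right' tsub_le_self)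
        (by rw [lintegral_count, hW]; exact ENNReal.one_ne_top)
        (ae_of_all _ fun j => by
          have h2 : Tendsto (fun i => 1 - X.μ i {ω | ∀ n, j < ω n}) atTop (𝓝 (1 - 1)) :=
            ENNReal.Tendsto.sub tendsto_const_nhds (htr j) (Or.inl ENNReal.one_ne_top)
          rw [tsub_self] at h2
          have h3 := ENNReal.Tendsto.const_mul (a := ENNReal.ofReal (w j)) h2
            (Or.inr ENNReal.ofReal_ne_top)
          simpa using h3)
      simpa [lintegral_count] using h1
    have ht2 : Tendsto (fun i => 1 + M *
        ∑' j, ENNReal.ofReal (w j) * (1 - X.μ i {ω | ∀ n, j < ω n})) atTop (𝓝 1) := by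
      have h3 := (ENNReal.Tendsto.const_mul (a := M) ht (Or.inr hsup.ne)).const_add 1
      simpa using h3
    calc _ ≤ _ := limsup_le_limsup (Eventually.of_forall hb)
      _ = 1 := ht2.limsup_eq
end

section
/- Let (Xₙ) be a positive recurrent Markov chain on ℤ₊ with invariant probabilities π(i) > 0, asymptotically homogeneous (ξ(i) ⇒ ξ as i → ∞, where ξ(i) is the jump from state i), with Eξ < 0, ℤ the minimal lattice of ξ, and Ee^{βξ} = 1, Eξe^{βξ} < ∞ for some β > 0. Suppose ξ(i) ≤_st Ξ for all i with EΞe^{βΞ} < ∞, and ∑_{i=0}^∞ |Ee^{βξ(i)} − 1| < ∞. Then π(i) ∼ c e^{−βi} as i → ∞ for some constant c > 0. -/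
open MeasureTheory Filter Topology
open scoped ENNReal NNReal

lemma hasSum_congr0 {ι : Type*} {f g : ι → ℝ} {S : ℝ} (h : ∀ x, f x = g x) :
    HasSum f S ↔ HasSum g S := by
  rw [show f = g from funext h]

lemma hasSum_toReal0 {ι : Type*} {f : ι → ℝ≥0∞} (h : ∑' x, f x ≠ ∞) :
    HasSum (fun x => (f x).toReal) (∑' x, f x).toReal := by
  rw [ENNReal.tsum_toReal_eq (ENNReal.ne_top_of_tsum_ne_top h)]
  exact ENNReal.hasSum_toReal h

lemma tsub (j : ℤ) : Tendsto (fun i : ℤ => i - j) atTop atTop :=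
  tendsto_atTop_add_const_right atTop (-j) tendsto_id

lemma lemA (b : ℤ → ℝ) (A : ℝ) (hb : ∀ i, |b i| ≤ A) (p : ℤ → ℝ) (hp0 : ∀ j, 0 ≤ p j)
    (hp : HasSum p 1)
    (hh : Tendsto (fun i => b i - ∑' j, p j * b (i - j)) atTop (𝓝 0))
    (l : ℤ) (hl : 0 < p l) : ∀ ε > 0, ∀ᶠ i in atTop, b i - b (i - l) < ε := by
  have hsb : ∀ i, Summable fun j => p j * b (i - j) := fun i => by
    refine Summable.of_norm_bounded (hp.summable.mul_right A) fun j => ?_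
    rw [Real.norm_eq_abs, abs_mul, abs_of_nonneg (hp0 j)]
    exact mul_le_mul_of_nonneg_left (hb _) (hp0 j)
  set d : ℤ → ℝ := fun i => b i - b (i - l) with hd
  have hdb : ∀ i, |d i| ≤ 2 * A := fun i => by
    have := abs_sub (b i) (b (i - l)); have := hb i; have := hb (i - l); simp only [hd]; linarith
  have hA : 0 ≤ A := (abs_nonneg _).trans (hb 0)
  have hbu : IsBoundedUnder (· ≤ ·) atTop d :=
    isBoundedUnder_of ⟨2 * A, fun i => (abs_le.1 (hdb i)).2⟩
  have hbl : IsBoundedUnder (· ≥ ·) atTop d :=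
    isBoundedUnder_of ⟨-(2 * A), fun i => (abs_le.1 (hdb i)).1⟩
  set D := limsup d atTop with hD
  have hup : ∀ ε > 0, ∀ᶠ i in atTop, d i < D + ε := fun ε hε =>
    eventually_lt_of_limsup_lt (by linarith) hbu
  have hfr : ∀ ε > 0, ∃ᶠ i in atTop, D - ε < d i := fun ε hε =>
    frequently_lt_of_lt_limsup hbl.isCoboundedUnder_le (by linarith)
  have hcl : MapClusterPt D atTop d := by
    rw [Metric.nhds_basis_ball.mapClusterPt_iff_frequently]
    intro ε hε
    refine ((hfr ε hε).and_eventually (hup ε hε)).mono fun i hi => ?_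
    rw [Metric.mem_ball, Real.dist_eq, abs_lt]; constructor <;> linarith [hi.1, hi.2]
  obtain ⟨U, hU, hUd⟩ := mapClusterPt_iff_ultrafilter.1 hcl
  -- error terms
  have he : Tendsto (fun i => max (d i - D) 0) atTop (𝓝 0) := by
    rw [Metric.tendsto_nhds]
    intro ε hε
    filter_upwards [hup ε hε] with i hi
    rw [Real.dist_eq, sub_zero, abs_of_nonneg (le_max_right _ _)]
    exact max_lt (by linarith) hε
  have hDb : |D| ≤ 2 * A := by
    have := hUd.abs
    exact le_of_tendsto this (Eventually.of_forall hdb)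
  have heb : ∀ i, |max (d i - D) 0| ≤ 4 * A := fun i => by
    rw [abs_of_nonneg (le_max_right _ _)]
    refine max_le ?_ (by linarith)
    have := (abs_le.1 (hdb i)).2; have := (abs_le.1 hDb).1; linarith
  have hes : Tendsto (fun i => ∑' j, p j * max (d (i - j) - D) 0) atTop (𝓝 0) := by
    have := tendsto_tsum_of_dominated_convergence (𝓕 := (atTop : Filter ℤ))
      (f := fun i j => p j * max (d (i - j) - D) 0) (g := fun _ => (0 : ℝ))
      (bound := fun j => p j * (4 * A)) (hp.summable.mul_right _)
      (fun j => by simpa using (he.comp (tsub j)).const_mul (p j))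
      (Eventually.of_forall fun i j => by
        rw [Real.norm_eq_abs, abs_mul, abs_of_nonneg (hp0 j)]
        exact mul_le_mul_of_nonneg_left (heb _) (hp0 j))
    simpa using this
  set η : ℤ → ℝ := fun i => b i - ∑' j, p j * b (i - j) with hη
  have hηd : Tendsto (fun i => η i - η (i - l)) atTop (𝓝 0) := by
    simpa using hh.sub (hh.comp (tsub l))
  have key : ∀ i, d i - D ≤ p l * (d (i - l) - D) + ∑' j, p j * max (d (i - j) - D) 0
      + (η i - η (i - l)) := by
    intro i
    have h1 : HasSum (fun j => p j * (d (i - j) - D))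
        ((∑' j, p j * b (i - j)) - (∑' j, p j * b (i - l - j)) - 1 * D) := by
      have := (((hsb i).hasSum.sub (hsb (i - l)).hasSum).sub (hp.mul_right D))
      refine (hasSum_congr0 fun j => ?_).2 this
      change p j * (b (i - j) - b (i - j - l) - D) = _
      rw [show i - j - l = i - l - j by ring]; ring
    have h2 : Summable (fun j => p j * max (d (i - j) - D) 0) := by
      refine Summable.of_norm_bounded (hp.summable.mul_right (4 * A)) fun j => ?_
      rw [Real.norm_eq_abs, abs_mul, abs_of_nonneg (hp0 j)]
      exact mul_le_mul_of_nonneg_left (heb _) (hp0 j)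
    have h3 : HasSum (fun j => if j = l then p l * (d (i - l) - D) else 0)
        (p l * (d (i - l) - D)) := by
      simpa using hasSum_ite_eq l (p l * (d (i - l) - D))
    have h4 := hasSum_le (f := fun j => p j * (d (i - j) - D)) (fun j => ?_) h1 (h3.add h2.hasSum)
    · simp only [hη, hd] at h4 ⊢
      linarith
    · have := le_max_left (d (i - j) - D) 0
      have h0 := le_max_right (d (i - j) - D) 0
      split_ifs with h
      · subst h; nlinarith [mul_nonneg (hp0 j) h0]
      · simpa using mul_le_mul_of_nonneg_left this (hp0 j)
  have step : ∀ m : ℕ, Tendsto (fun i => d (i - m * l)) U (𝓝 D) := by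
    intro m
    induction m with
    | zero => simpa using hUd
    | succ m ih =>
      have hUm : Tendsto (fun i : ℤ => i - m * l) U atTop := (tsub _).mono_left hU
      have hUm1 : Tendsto (fun i : ℤ => i - (m + 1 : ℕ) * l) U atTop := (tsub _).mono_left hU
      have hlow : Tendsto (fun i : ℤ => D + ((d (i - m * l) - D) -
          (∑' j, p j * max (d (i - m * l - j) - D) 0) - (η (i - m * l) - η (i - m * l - l))) / p l)
          U (𝓝 D) := by
        have := ((((ih.sub_const D).sub (hes.comp hUm)).sub (hηd.comp hUm)).div_const
          (p l)).const_add D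
        simpa using this
      have hhigh : Tendsto (fun i : ℤ => D + max (d (i - (m + 1 : ℕ) * l) - D) 0) U (𝓝 D) := by
        simpa using (he.comp hUm1).const_add D
      refine tendsto_of_tendsto_of_tendsto_of_le_of_le hlow hhigh ?_ ?_
      · intro i
        have := key (i - m * l)
        simp only
        rw [show i - ((m + 1 : ℕ) : ℤ) * l = i - m * l - l by push_cast; ring]
        have h5 : ((d (i - m * l) - D) -
          (∑' j, p j * max (d (i - m * l - j) - D) 0) - (η (i - m * l) - η (i - m * l - l))) / p l
            ≤ d (i - m * l - l) - D := by
          rw [div_le_iff₀ hl]; linarith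
        linarith
      · intro i
        simp only
        linarith [le_max_left (d (i - (m + 1 : ℕ) * l) - D) 0]
  have tel : ∀ m : ℕ, ∀ i, b i - b (i - m * l) = ∑ t ∈ Finset.range m, d (i - t * l) := by
    intro m i
    induction m with
    | zero => simp
    | succ m ih =>
      rw [Finset.sum_range_succ, ← ih]
      simp only [hd]
      rw [show i - ((m + 1 : ℕ) : ℤ) * l = i - m * l - l by push_cast; ring]; ring
  have hm : ∀ m : ℕ, (m : ℝ) * D ≤ 2 * A := by
    intro m
    have h1 : Tendsto (fun i => b i - b (i - m * l)) U (𝓝 (m * D)) := by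
      simp_rw [tel m]
      have := tendsto_finsetSum (Finset.range m) (fun t _ => step t)
      simpa using this
    refine le_of_tendsto h1 (Eventually.of_forall fun i => ?_)
    have := (abs_le.1 (hb i)).2; have := (abs_le.1 (hb (i - m * l))).1; linarith
  have hD0 : D ≤ 0 := by
    by_contra hc
    push Not at hc
    obtain ⟨m, hm'⟩ := exists_nat_gt (2 * A / D)
    rw [div_lt_iff₀ hc] at hm'
    linarith [hm m]
  intro ε hε
  filter_upwards [hup ε hε] with i hi
  simp only [hd] at hi; linarith

lemma lemB (b : ℤ → ℝ) (A : ℝ) (hb : ∀ i, |b i| ≤ A) (p : ℤ → ℝ) (hp0 : ∀ j, 0 ≤ p j)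
    (hp : HasSum p 1)
    (hh : Tendsto (fun i => b i - ∑' j, p j * b (i - j)) atTop (𝓝 0))
    (hlat : ∀ d : ℕ, 2 ≤ d → ∃ j₁ j₂ : ℤ, p j₁ ≠ 0 ∧ p j₂ ≠ 0 ∧ ¬ (d : ℤ) ∣ (j₁ - j₂)) (l : ℤ) :
    Tendsto (fun i => b (i - l) - b i) atTop (𝓝 0) := by
  let H : AddSubgroup ℤ :=
    { carrier := {l | Tendsto (fun i => b (i - l) - b i) atTop (𝓝 0)}
      zero_mem' := by simp
      add_mem' := by
        intro x y hx hy
        have := (hx.comp (tsub y)).add hy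
        simp only [Set.mem_ofPred_eq, add_zero] at this ⊢
        refine this.congr fun i => ?_
        simp only [Function.comp]
        rw [show i - (x + y) = i - y - x by ring]; ring
      neg_mem' := by
        intro x hx
        have := (hx.comp (tsub (-x))).neg
        simp only [Set.mem_ofPred_eq, neg_zero] at this ⊢
        refine this.congr fun i => ?_
        simp only [Function.comp]
        rw [show i - -x - x = i by ring]; ring }
  have hmem : ∀ j, p j ≠ 0 → j ∈ H := by
    intro j hj
    have hj' : 0 < p j := lt_of_le_of_ne (hp0 j) (Ne.symm hj)
    have h1 := lemA b A hb p hp0 hp hh j hj'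
    have h2 := lemA (fun i => - b i) A (by simpa using hb) p hp0 hp (by
      have := hh.neg
      simp only [neg_zero] at this
      refine this.congr fun i => ?_
      simp only [mul_neg, tsum_neg]; ring) j hj'
    change Tendsto (fun i => b (i - j) - b i) atTop (𝓝 0)
    rw [Metric.tendsto_nhds]
    intro ε hε
    filter_upwards [h1 ε hε, h2 ε hε] with i h3 h4
    rw [Real.dist_eq, abs_lt]; constructor <;> linarith
  obtain ⟨g, hg⟩ := Int.subgroup_cyclic H
  have hdvd : ∀ j, j ∈ H ↔ g ∣ j := by
    intro j; rw [hg, ← AddSubgroup.zmultiples_eq_closure, Int.mem_zmultiples_iff]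
  have : l ∈ H := by
    rw [hdvd]
    rcases Nat.lt_or_ge g.natAbs 2 with h | h
    · interval_cases hn : g.natAbs
      · obtain ⟨j₁, j₂, h1, h2, h3⟩ := hlat 2 le_rfl
        rw [Int.natAbs_eq_zero] at hn
        have a1 := (hdvd _).1 (hmem _ h1); have a2 := (hdvd _).1 (hmem _ h2)
        rw [hn, zero_dvd_iff] at a1 a2
        simp [a1, a2] at h3
      · exact (Int.isUnit_iff_natAbs_eq.2 hn).dvd
    · obtain ⟨j₁, j₂, h1, h2, h3⟩ := hlat _ h
      exact absurd (Int.natAbs_dvd.2 (dvd_sub ((hdvd _).1 (hmem _ h1)) ((hdvd _).1 (hmem _ h2)))) h3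
  exact this

lemma lemC (a : ℤ → ℝ) (ha0 : ∀ i < 0, a i = 0) (hapos : ∀ i, 0 ≤ i → 0 < a i)
    (s : ℤ → ℤ → ℝ) (p D : ℤ → ℝ) (hs0 : ∀ i j, 0 ≤ s i j) (hsD : ∀ i j, s i j ≤ D j)
    (hD : Summable D) (hsp : ∀ j, Tendsto (fun i => s i j) atTop (𝓝 (p j))) (hp : HasSum p 1)
    (hinv : ∀ i, 0 ≤ i → a i = ∑' j, s (i - j) j * a (i - j))
    (hlat : ∀ d : ℕ, 2 ≤ d → ∃ j₁ j₂ : ℤ, p j₁ ≠ 0 ∧ p j₂ ≠ 0 ∧ ¬ (d : ℤ) ∣ (j₁ - j₂))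
    (W : ℤ → ℤ → ℝ) (V Wi : ℤ → ℝ) (hW0 : ∀ i k, 0 ≤ W i k) (hWV : ∀ i k, W i k ≤ V k)
    (hV : Summable V) (hWl : ∀ k, Tendsto (fun i => W i k) atTop (𝓝 (Wi k))) (hW00 : 0 < Wi 0)
    (δ : ℕ → ℝ) (hδ : Summable fun x => |δ x|)
    (hid : ∀ n : ℕ, HasSum (fun k : ℤ => a (n - k) * W (n - k) k)
      (∑ x ∈ Finset.range (n + 1), a x * δ x)) :
    ∃ c > (0 : ℝ), Tendsto (fun n : ℕ => a n) atTop (𝓝 c) := by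
  have hann : ∀ i, 0 ≤ a i := fun i => by
    rcases lt_or_ge i 0 with h | h
    · exact (ha0 i h).ge
    · exact (hapos i h).le
  have hE : ∀ n : ℕ, a n * W n 0 ≤ ∑ x ∈ Finset.range (n + 1), a x * δ x := fun n => by
    have := le_hasSum (hid n) 0 (fun k _ => mul_nonneg (hann _) (hW0 _ _))
    simpa using this
  set κ := Wi 0 / 2 with hκ
  have hκ0 : 0 < κ := by positivity
  have hWn : ∀ᶠ n : ℕ in atTop, κ ≤ W n 0 := by
    have : Tendsto (fun n : ℕ => W n 0) atTop (𝓝 (Wi 0)) :=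
      (hWl 0).comp tendsto_natCast_atTop_atTop
    exact (this.eventually (lt_mem_nhds (show κ < Wi 0 by linarith))).mono fun _ h => h.le
  have htail : ∀ᶠ n : ℕ in atTop, ∑' x, |δ (x + n)| < κ / 2 :=
    (tendsto_sum_nat_add (fun x => |δ x|)).eventually (gt_mem_nhds (by positivity))
  obtain ⟨M, hM⟩ := eventually_atTop.1 (hWn.and htail)
  -- boundedness
  have hbd : ∃ A, ∀ i, a i ≤ A := by
    set C := ∑ x ∈ Finset.range M, a x * |δ x| with hC
    have hC0 : 0 ≤ C := Finset.sum_nonneg fun x _ => mul_nonneg (hann _) (abs_nonneg _)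
    have h1 : ∀ n : ℕ, M ≤ n → a n ≤ 2 * C / κ := by
      intro n
      induction n using Nat.strong_induction_on with
      | _ n ih =>
        intro hn
        by_contra hc
        push Not at hc
        have h2 := hE n
        have h3 : ∑ x ∈ Finset.range (n + 1), a x * δ x ≤
            ∑ x ∈ Finset.range (n + 1), a x * |δ x| :=
          Finset.sum_le_sum fun x _ => mul_le_mul_of_nonneg_left (le_abs_self _) (hann _)
        have h4 : ∑ x ∈ Finset.range (n + 1), a x * |δ x| =
            C + ∑ x ∈ Finset.range (n + 1 - M), a (x + M : ℕ) * |δ (x + M)| := by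
          rw [hC, ← Finset.sum_range_add_sum_Ico _ (show M ≤ n + 1 by omega),
            Finset.sum_Ico_eq_sum_range]
          congr 1
          exact Finset.sum_congr rfl fun x _ => by rw [add_comm]
        have h5 : ∑ x ∈ Finset.range (n + 1 - M), a (x + M : ℕ) * |δ (x + M)| ≤
            ∑ x ∈ Finset.range (n + 1 - M), a n * |δ (x + M)| := by
          refine Finset.sum_le_sum fun x hx => mul_le_mul_of_nonneg_right ?_ (abs_nonneg _)
          rw [Finset.mem_range] at hx
          rcases Nat.lt_or_ge (x + M) n with h | h
          · exact (ih _ h (by omega)).trans hc.le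
          · rw [show x + M = n by omega]
        rw [← Finset.mul_sum] at h5
        have h6 : ∑ x ∈ Finset.range (n + 1 - M), |δ (x + M)| ≤ κ / 2 :=
          (((summable_nat_add_iff M).2 hδ).sum_le_tsum _ (fun x _ => abs_nonneg _)).trans
            (hM M le_rfl).2.le
        have h7 := mul_le_mul_of_nonneg_left h6 (hann n)
        have h8 := mul_le_mul_of_nonneg_left (hM n hn).1 (hann n)
        rw [div_lt_iff₀ hκ0] at hc
        nlinarith
    refine ⟨2 * C / κ + ∑ x ∈ Finset.range M, a x, fun i => ?_⟩
    have hs : 0 ≤ ∑ x ∈ Finset.range M, a x := Finset.sum_nonneg fun x _ => hann _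
    have hs' : 0 ≤ 2 * C / κ := by positivity
    rcases lt_or_ge i 0 with h | h
    · rw [ha0 i h]; linarith
    · lift i to ℕ using h
      rcases Nat.lt_or_ge i M with h | h
      · have := Finset.single_le_sum (f := fun x : ℕ => a x) (fun x _ => hann _)
          (Finset.mem_range.2 h)
        linarith
      · linarith [h1 i h]
  obtain ⟨A, hA⟩ := hbd
  have hA0 : 0 ≤ A := (hann 0).trans (hA 0)
  have habs : ∀ i, |a i| ≤ A := fun i => by rw [abs_of_nonneg (hann i)]; exact hA i
  have hpD : ∀ j, p j ≤ D j := fun j => le_of_tendsto (hsp j) (Eventually.of_forall fun i => hsD i j)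
  have hp0 : ∀ j, 0 ≤ p j := fun j => ge_of_tendsto (hsp j) (Eventually.of_forall fun i => hs0 i j)
  have hWi0 : ∀ j, 0 ≤ Wi j := fun j => ge_of_tendsto (hWl j) (Eventually.of_forall fun i => hW0 i j)
  have hWiV : ∀ j, Wi j ≤ V j := fun j => le_of_tendsto (hWl j) (Eventually.of_forall fun i => hWV i j)
  have hDn : ∀ j, 0 ≤ D j := fun j => (hp0 j).trans (hpD j)
  have hVn : ∀ j, 0 ≤ V j := fun j => (hWi0 j).trans (hWiV j)
  have hdiff : ∀ (u v w : ℝ), 0 ≤ u → u ≤ w → 0 ≤ v → v ≤ w → |u - v| ≤ w := by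
    intro u v w h1 h2 h3 h4; rw [abs_le]; constructor <;> linarith
  have hh : Tendsto (fun i => a i - ∑' j, p j * a (i - j)) atTop (𝓝 0) := by
    have := tendsto_tsum_of_dominated_convergence (𝓕 := (atTop : Filter ℤ))
      (f := fun i j => (s (i - j) j - p j) * a (i - j)) (g := fun _ => (0 : ℝ))
      (bound := fun j => D j * A) (hD.mul_right _)
      (fun j => by
        have h1 : Tendsto (fun i => s (i - j) j - p j) atTop (𝓝 0) := by
          simpa using ((hsp j).comp (tsub j)).sub_const (p j)
        refine h1.zero_mul_isBoundedUnder_le ?_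
        exact isBoundedUnder_of ⟨A, fun i => habs _⟩)
      (Eventually.of_forall fun i j => by
        rw [Real.norm_eq_abs, abs_mul]
        exact mul_le_mul (hdiff _ _ _ (hs0 _ _) (hsD _ _) (hp0 _) (hpD _)) (habs _)
          (abs_nonneg _) (hDn _))
    rw [tsum_zero] at this
    refine this.congr' ?_
    filter_upwards [eventually_ge_atTop 0] with i hi
    rw [hinv i hi, ← Summable.tsum_sub]
    · exact tsum_congr fun j => by ring
    · refine Summable.of_norm_bounded (hD.mul_right A) fun j => ?_
      rw [Real.norm_eq_abs, abs_mul, abs_of_nonneg (hs0 _ _)]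
      exact mul_le_mul (hsD _ _) (habs _) (abs_nonneg _) (hDn _)
    · refine Summable.of_norm_bounded (hD.mul_right A) fun j => ?_
      rw [Real.norm_eq_abs, abs_mul, abs_of_nonneg (hp0 _)]
      exact mul_le_mul (hpD _) (habs _) (abs_nonneg _) (hDn _)
  have hslow := lemB a A habs p hp0 hp hh hlat
  have hWis : Summable Wi := Summable.of_nonneg_of_le hWi0 hWiV hV
  set w := ∑' k, Wi k with hw
  have hw0 : 0 < w := hWis.tsum_pos hWi0 0 hW00
  have hdx : Summable fun x : ℕ => a x * δ x := by
    refine Summable.of_norm_bounded (hδ.mul_left A) fun x => ?_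
    rw [Real.norm_eq_abs, abs_mul]
    exact mul_le_mul_of_nonneg_right (habs _) (abs_nonneg _)
  set F := ∑' x : ℕ, a x * δ x with hF
  have hEF : Tendsto (fun n : ℕ => ∑ x ∈ Finset.range (n + 1), a x * δ x) atTop (𝓝 F) :=
    (hdx.hasSum.tendsto_sum_nat).comp (tendsto_add_atTop_nat 1)
  have hlim0 : Tendsto (fun n : ℕ => (∑ x ∈ Finset.range (n + 1), a x * δ x) - a n * w) atTop
      (𝓝 0) := by
    have hnk : ∀ k : ℤ, Tendsto (fun n : ℕ => (n : ℤ) - k) atTop atTop := fun k =>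
      (tsub k).comp tendsto_natCast_atTop_atTop
    have := tendsto_tsum_of_dominated_convergence (𝓕 := (atTop : Filter ℕ))
      (f := fun (n : ℕ) (k : ℤ) => a (n - k) * W (n - k) k - a n * Wi k) (g := fun _ => (0 : ℝ))
      (bound := fun j => A * V j) (hV.mul_left _)
      (fun k => by
        have h1 : Tendsto (fun n : ℕ => W (n - k) k - Wi k) atTop (𝓝 0) := by
          simpa using ((hWl k).comp (hnk k)).sub_const (Wi k)
        have h2 : Tendsto (fun n : ℕ => (W (n - k) k - Wi k) * a (n - k)) atTop (𝓝 0) :=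
          h1.zero_mul_isBoundedUnder_le (isBoundedUnder_of ⟨A, fun i => habs _⟩)
        have h3 : Tendsto (fun n : ℕ => (a (n - k) - a n) * Wi k) atTop (𝓝 0) := by
          simpa using ((hslow k).comp tendsto_natCast_atTop_atTop).mul_const (Wi k)
        have := h2.add h3
        rw [add_zero] at this
        exact this.congr fun n => by ring)
      (Eventually.of_forall fun i j => by
        rw [Real.norm_eq_abs]
        exact hdiff _ _ _ (mul_nonneg (hann _) (hW0 _ _))
          (mul_le_mul (hA _) (hWV _ _) (hW0 _ _) hA0) (mul_nonneg (hann _) (hWi0 _))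
          (mul_le_mul (hA _) (hWiV _) (hWi0 _) hA0))
    rw [tsum_zero] at this
    refine this.congr fun n => ?_
    exact ((hid n).sub (hWis.hasSum.mul_left (a n))).tsum_eq
  have hlim : Tendsto (fun n : ℕ => a n) atTop (𝓝 (F / w)) := by
    have := (hEF.sub hlim0).div_const w
    rw [sub_zero] at this
    refine this.congr fun n => ?_
    field_simp; ring
  have hF0 : 0 ≤ F / w := ge_of_tendsto hlim (Eventually.of_forall fun n => hann _)
  refine ⟨F / w, lt_of_le_of_ne hF0 fun hz => ?_, hlim⟩
  have hFz : F = 0 := by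
    rcases div_eq_zero_iff.1 hz.symm with h | h
    · exact h
    · exact absurd h hw0.ne'
  have hback : ∀ B, (∀ n : ℕ, M ≤ n → a n ≤ B) → ∀ n : ℕ, M ≤ n → a n ≤ B / 2 := by
    intro B hB n hn
    have hB0 : 0 ≤ B := (hann _).trans (hB n hn)
    have h1 : ∑ x ∈ Finset.range (n + 1), a x * δ x = - ∑' x : ℕ, a (x + (n + 1) : ℕ) * δ (x + (n + 1)) := by
      have := hdx.sum_add_tsum_nat_add (n + 1)
      rw [← hF, hFz] at this
      linarith
    have h2 : - ∑' x : ℕ, a (x + (n + 1) : ℕ) * δ (x + (n + 1)) ≤ ∑' x, B * |δ (x + (n + 1))| := by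
      rw [← tsum_neg]
      refine Summable.tsum_le_tsum (fun x => ?_) ((summable_nat_add_iff (n + 1)).2 hdx).neg
        (((summable_nat_add_iff (n + 1)).2 hδ).mul_left B)
      have h3 := hB (x + (n + 1)) (by omega)
      have h4 := hann (x + (n + 1) : ℕ)
      have h5 := neg_abs_le (δ (x + (n + 1)))
      have h6 := mul_le_mul_of_nonneg_right h3 (abs_nonneg (δ (x + (n + 1))))
      nlinarith
    rw [tsum_mul_left] at h2
    have h3 := mul_le_mul_of_nonneg_left (hM (n + 1) (by omega)).2.le hB0
    have h4 := hE n
    have h8 := mul_le_mul_of_nonneg_left (hM n hn).1 (hann n)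
    have h9 : κ * a n ≤ κ * (B / 2) := by linarith
    exact le_of_mul_le_mul_left h9 hκ0
  have hpow : ∀ m : ℕ, a M ≤ A * (1 / 2) ^ m := by
    intro m
    have : ∀ n : ℕ, M ≤ n → a n ≤ A * (1 / 2) ^ m := by
      induction m with
      | zero => intro n _; simpa using hA n
      | succ m ih =>
        intro n hn
        have := hback _ ih n hn
        rw [pow_succ]; linarith
    exact this M le_rfl
  have : a M ≤ 0 := by
    have h1 : Tendsto (fun m : ℕ => A * (1 / 2 : ℝ) ^ m) atTop (𝓝 (A * 0)) :=
      (tendsto_pow_atTop_nhds_zero_of_lt_one (by norm_num) (by norm_num)).const_mul A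
    rw [mul_zero] at h1
    exact ge_of_tendsto h1 (Eventually.of_forall hpow)
  linarith [hapos M (by positivity)]

lemma lemE (β : ℝ) (hβ : 0 < β) (Ξ : ℤ → ℝ≥0∞)
    (hΞmom : ∑' j : ℤ, ENNReal.ofReal ((j : ℝ) * Real.exp (β * j)) * Ξ j < ∞) :
    (∑' k : ℕ, ∑' j : ℤ, if (k : ℤ) < j then ENNReal.ofReal (Real.exp (β * j)) *
      (∑' l : ℤ, if j - 1 < l then Ξ l else 0) else 0) ≠ ∞ := by
  set e : ℤ → ℝ≥0∞ := fun j => ENNReal.ofReal (Real.exp (β * j)) with he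
  set c : ℝ≥0∞ := ∑' m : ℕ, ENNReal.ofReal (Real.exp (-β * m)) with hc
  have hcfin : c ≠ ∞ := by
    have : Summable fun m : ℕ => Real.exp (-β * m) := by
      have := Real.summable_exp_nat_mul_of_ge (c := -β) (by linarith) (f := fun n => (n : ℝ))
        (fun i => le_rfl)
      simpa using this
    exact this.tsum_ofReal_ne_top
  have h1 : (∑' k : ℕ, ∑' j : ℤ, if (k : ℤ) < j then e j *
      (∑' l : ℤ, if j - 1 < l then Ξ l else 0) else 0) =
      ∑' l : ℤ, ∑' j : ℤ, ∑' k : ℕ, if (k : ℤ) < j then (if j ≤ l then e j * Ξ l else 0) else 0 := by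
    have : ∀ k : ℕ, ∀ j : ℤ, (if (k : ℤ) < j then e j *
      (∑' l : ℤ, if j - 1 < l then Ξ l else 0) else 0) =
        ∑' l : ℤ, if (k : ℤ) < j then (if j ≤ l then e j * Ξ l else 0) else 0 := by
      intro k j
      split_ifs with h
      · rw [← ENNReal.tsum_mul_left]
        refine tsum_congr fun l => ?_
        by_cases hjl : j ≤ l
        · rw [if_pos hjl, if_pos (by omega)]
        · rw [if_neg hjl, if_neg (by omega), mul_zero]
      · simp
    simp_rw [this]
    rw [ENNReal.tsum_comm]
    rw [ENNReal.tsum_comm (f := fun (l : ℤ) (j : ℤ) => ∑' k : ℕ,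
      if (k : ℤ) < j then (if j ≤ l then e j * Ξ l else 0) else 0)]
    exact tsum_congr fun j => ENNReal.tsum_comm
  have hk : ∀ (j : ℤ) (x : ℝ≥0∞), (∑' k : ℕ, if (k : ℤ) < j then x else 0) = (j.toNat : ℝ≥0∞) * x := by
    intro j x
    rw [tsum_eq_sum (s := Finset.range j.toNat)]
    · rw [Finset.sum_congr rfl (g := fun _ => x)]
      · simp
      · intro k hk; rw [Finset.mem_range] at hk; rw [if_pos (by omega)]
    · intro k hk; rw [Finset.mem_range] at hk; rw [if_neg (by omega)]
  have hj : ∀ l : ℤ, (∑' j : ℤ, if j ≤ l then e j else 0) = e l * c := by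
    intro l
    have hinj : Function.Injective (fun m : ℕ => l - (m : ℤ)) := fun x y h => by
      simp only at h; omega
    rw [← hinj.tsum_eq]
    · rw [hc, ← ENNReal.tsum_mul_left]
      refine tsum_congr fun m => ?_
      rw [if_pos (by omega), he]
      simp only
      rw [← ENNReal.ofReal_mul (Real.exp_pos _).le, ← Real.exp_add]
      congr 2; push_cast; ring
    · intro j hj
      rw [Function.mem_support] at hj
      have : j ≤ l := by by_contra h; exact hj (if_neg h)
      exact ⟨(l - j).toNat, by simp only; omega⟩
  rw [h1]
  simp_rw [hk]
  have h2 : ∀ l : ℤ, (∑' j : ℤ, (j.toNat : ℝ≥0∞) * (if j ≤ l then e j * Ξ l else 0)) ≤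
      (ENNReal.ofReal ((l : ℝ) * Real.exp (β * l)) * Ξ l) * c := by
    intro l
    calc _ ≤ ∑' j : ℤ, ((l.toNat : ℝ≥0∞) * Ξ l) * (if j ≤ l then e j else 0) := by
          refine ENNReal.tsum_le_tsum fun j => ?_
          split_ifs with h
          · have : (j.toNat : ℝ≥0∞) ≤ l.toNat := by exact_mod_cast Int.toNat_le_toNat h
            calc _ = (j.toNat : ℝ≥0∞) * Ξ l * e j := by ring
              _ ≤ _ := by gcongr
          · simp
      _ = (l.toNat : ℝ≥0∞) * Ξ l * (e l * c) := by rw [ENNReal.tsum_mul_left, hj]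
      _ = ((l.toNat : ℝ≥0∞) * e l) * Ξ l * c := by ring
      _ ≤ _ := by
          gcongr
          rcases le_or_gt l 0 with h | h
          · simp [Int.toNat_of_nonpos h]
          · lift l to ℕ using h.le
            rw [he, ENNReal.ofReal_mul (by positivity)]
            simp
  refine ne_top_of_le_ne_top ?_ (ENNReal.tsum_le_tsum h2)
  rw [ENNReal.tsum_mul_right]
  exact ENNReal.mul_ne_top hΞmom.ne hcfin

lemma lemF (π : ℕ → ℝ) (hπpos : ∀ i, 0 < π i) (hπsum : HasSum π 1) (p : ℕ → ℕ → ℝ)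
    (hp0 : ∀ i j, 0 ≤ p i j) (hp1 : ∀ i, HasSum (p i) 1)
    (hπinv : ∀ i, HasSum (fun j => π j * p j i) (π i)) (f : ℕ → ℝ) (C : ℝ)
    (hf0 : ∀ y, 0 ≤ f y) (hfC : ∀ y, f y ≤ C) :
    HasSum (fun x => π x * (∑' y, p x y * f y - f x)) 0 := by
  have hrow : ∀ x, Summable fun y => p x y * f y := fun x =>
    Summable.of_nonneg_of_le (fun y => mul_nonneg (hp0 _ _) (hf0 _))
      (fun y => mul_le_mul_of_nonneg_left (hfC y) (hp0 _ _)) ((hp1 x).summable.mul_right C)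
  have hrowle : ∀ x, ∑' y, p x y * f y ≤ C := fun x => by
    have h : HasSum (fun y => p x y * C) (1 * C) := (hp1 x).mul_right C
    rw [one_mul] at h
    exact hasSum_le (f := fun y => p x y * f y) (g := fun y => p x y * C)
      (fun y => mul_le_mul_of_nonneg_left (hfC y) (hp0 x y)) (hrow x).hasSum h
  have hS : Summable fun z : ℕ × ℕ => π z.1 * (p z.1 z.2 * f z.2) := by
    refine (summable_prod_of_nonneg (f := fun z : ℕ × ℕ => π z.1 * (p z.1 z.2 * f z.2)) ?_).2 ?_
    swap
    · refine ⟨fun x => (hrow x).mul_left (π x), ?_⟩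
      have : Summable fun x => π x * ∑' y, p x y * f y := ?_
      · exact this.congr fun x => (tsum_mul_left ..).symm
      exact Summable.of_nonneg_of_le
        (fun x => mul_nonneg (hπpos x).le (tsum_nonneg fun y => mul_nonneg (hp0 _ _) (hf0 _)))
        (fun x => mul_le_mul_of_nonneg_left (hrowle x) (hπpos x).le) (hπsum.summable.mul_right C)
    · intro z; exact mul_nonneg (hπpos _).le (mul_nonneg (hp0 _ _) (hf0 _))
  have h1 : HasSum (fun x => π x * ∑' y, p x y * f y)
      (∑' z : ℕ × ℕ, π z.1 * (p z.1 z.2 * f z.2)) :=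
    hS.hasSum.prod_fiberwise (fun x => (hrow x).hasSum.mul_left (π x))
  have hS2 : HasSum (fun z : ℕ × ℕ => π z.2 * (p z.2 z.1 * f z.1))
      (∑' z : ℕ × ℕ, π z.1 * (p z.1 z.2 * f z.2)) :=
    (Equiv.prodComm ℕ ℕ).hasSum_iff.2 hS.hasSum
  have h2 : HasSum (fun y => π y * f y) (∑' z : ℕ × ℕ, π z.1 * (p z.1 z.2 * f z.2)) := by
    refine hS2.prod_fiberwise (fun y => ?_)
    exact (hasSum_congr0 fun x => by ring).1 ((hπinv y).mul_right (f y))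
  have h3 := h1.sub h2
  rw [sub_self] at h3
  exact (hasSum_congr0 fun x => by ring).1 h3

theorem stmt16 (X : MC) (π : ℕ → ℝ)
    (hπpos : ∀ i, 0 < π i) (hπsum : HasSum π 1)
    (hπinv : ∀ i, HasSum (fun j => π j * (X.P j i).toReal) (π i))
    (ν : ℤ → ℝ≥0∞) (hν : ∑' j, ν j = 1)
    (hconv : ∀ j : ℤ, Tendsto (fun i => jumpP X i j) atTop (𝓝 (ν j)))
    (hmint : Summable fun j : ℤ => |(j : ℝ)| * (ν j).toReal)
    (hmean : ∑' j : ℤ, (j : ℝ) * (ν j).toReal < 0)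
    (hlattice : ∀ d : ℕ, 2 ≤ d →
      ∃ j₁ j₂ : ℤ, ν j₁ ≠ 0 ∧ ν j₂ ≠ 0 ∧ ¬ (d : ℤ) ∣ (j₁ - j₂))
    (β : ℝ) (hβ : 0 < β)
    (hcram : ∑' j : ℤ, ENNReal.ofReal (Real.exp (β * j)) * ν j = 1)
    (hcram2 : ∑' j : ℤ, ENNReal.ofReal ((j : ℝ) * Real.exp (β * j)) * ν j < ∞)
    (Ξ : ℤ → ℝ≥0∞) (hΞ : ∑' j, Ξ j = 1)
    (hdom : ∀ (i : ℕ) (t : ℤ),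
      (∑' j : ℤ, if t < j then jumpP X i j else 0) ≤ ∑' j : ℤ, if t < j then Ξ j else 0)
    (hΞmom : ∑' j : ℤ, ENNReal.ofReal ((j : ℝ) * Real.exp (β * j)) * Ξ j < ∞)
    (hfin : ∀ i : ℕ, (∑' j : ℤ, ENNReal.ofReal (Real.exp (β * j)) * jumpP X i j) ≠ ∞)
    (hsum : Summable fun i : ℕ =>
      |(∑' j : ℤ, ENNReal.ofReal (Real.exp (β * j)) * jumpP X i j).toReal - 1|) :
    ∃ c > (0 : ℝ), Tendsto (fun i : ℕ => π i * Real.exp (β * i)) atTop (𝓝 c) := by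

  -- real-valued kernels
  set r : ℕ → ℤ → ℝ := fun i j => (jumpP X i j).toReal with hr
  set n' : ℤ → ℝ := fun j => (ν j).toReal with hn'
  set GE : ℤ → ℝ≥0∞ := fun j => ∑' l : ℤ, if j - 1 < l then Ξ l else 0 with hGE
  set D : ℤ → ℝ := fun j => Real.exp (β * j) * (GE j).toReal with hDdef
  have hGE1 : ∀ j, GE j ≤ 1 := fun j => by
    rw [← hΞ]
    exact ENNReal.tsum_le_tsum fun l => by split_ifs <;> simp
  have hGEtop : ∀ j, GE j ≠ ∞ := fun j => ne_top_of_le_ne_top ENNReal.one_ne_top (hGE1 j)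
  have hG1 : ∀ j, (GE j).toReal ≤ 1 := fun j => by
    simpa using ENNReal.toReal_mono ENNReal.one_ne_top (hGE1 j)
  have hjG : ∀ i j, jumpP X i j ≤ GE j := fun i j => by
    refine le_trans ?_ (hdom i (j - 1))
    refine le_trans ?_ (ENNReal.le_tsum j)
    rw [if_pos (by omega)]
  have hjtop : ∀ i j, jumpP X i j ≠ ∞ := fun i j => ne_top_of_le_ne_top (hGEtop j) (hjG i j)
  have hνtop : ∀ j, ν j ≠ ∞ := fun j =>
    ne_top_of_le_ne_top ENNReal.one_ne_top (hν ▸ ENNReal.le_tsum j)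
  have hr0 : ∀ i j, 0 ≤ r i j := fun i j => ENNReal.toReal_nonneg
  have hn0 : ∀ j, 0 ≤ n' j := fun j => ENNReal.toReal_nonneg
  have hrG : ∀ i j, r i j ≤ (GE j).toReal := fun i j => ENNReal.toReal_mono (hGEtop j) (hjG i j)
  have hrD : ∀ (i : ℕ) (j : ℤ), Real.exp (β * j) * r i j ≤ D j := fun i j =>
    mul_le_mul_of_nonneg_left (hrG i j) (Real.exp_pos _).le
  have hrn : ∀ j, Tendsto (fun i => r i j) atTop (𝓝 (n' j)) := fun j =>
    (ENNReal.tendsto_toReal (hνtop j)).comp (hconv j)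
  have hD0 : ∀ j, 0 ≤ D j := fun j => mul_nonneg (Real.exp_pos _).le ENNReal.toReal_nonneg
  have hnD : ∀ j : ℤ, Real.exp (β * j) * n' j ≤ D j := fun j =>
    le_of_tendsto ((hrn j).const_mul _) (Eventually.of_forall fun i => hrD i j)
  -- summability of D and tails
  have hE := lemE β hβ Ξ hΞmom
  have hDE : ∀ j : ℤ, D j = (ENNReal.ofReal (Real.exp (β * j)) * GE j).toReal := fun j => by
    rw [ENNReal.toReal_mul, ENNReal.toReal_ofReal (Real.exp_pos _).le]
  set TE : ℕ → ℝ≥0∞ := fun k => ∑' j : ℤ, if (k : ℤ) < j then ENNReal.ofReal (Real.exp (β * j)) *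
      GE j else 0 with hTE
  have hTE1 : ∑' k, TE k ≠ ∞ := hE
  have hTEtop : ∀ k, TE k ≠ ∞ := fun k => ne_top_of_le_ne_top hTE1 (ENNReal.le_tsum k)
  have hTD : ∀ k : ℕ, HasSum (fun j : ℤ => if (k : ℤ) < j then D j else 0) (TE k).toReal := by
    intro k
    have := hasSum_toReal0 (f := fun j : ℤ => if (k : ℤ) < j then
      ENNReal.ofReal (Real.exp (β * j)) * GE j else 0) (hTEtop k)
    refine (hasSum_congr0 fun j => ?_).2 this
    split_ifs
    · exact hDE j
    · simp
  have hTs : Summable fun k => (TE k).toReal := ENNReal.summable_toReal hTE1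
  have hexps : Summable fun m : ℕ => Real.exp (β * ((-((m : ℤ) + 1) : ℤ) : ℝ)) := by
    have : Summable fun m : ℕ => Real.exp (-β * m) := by
      have := Real.summable_exp_nat_mul_of_ge (c := -β) (by linarith) (f := fun n => (n : ℝ))
        (fun i => le_rfl)
      simpa using this
    refine ((summable_nat_add_iff 1).2 this).congr fun m => ?_
    congr 1; push_cast; ring
  have hDs : Summable D := by
    refine Summable.of_nat_of_neg_add_one ?_ ?_
    · rw [← summable_nat_add_iff 1]
      have h1 := (hTD 0).summable.comp_injective
        (i := fun n : ℕ => ((n + 1 : ℕ) : ℤ)) (fun x y h => by simpa using h)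
      refine h1.congr fun m => ?_
      simp only [Function.comp]
      rw [if_pos (by push_cast; omega)]
    · refine Summable.of_nonneg_of_le (fun m => hD0 _) (fun m => ?_) hexps
      exact mul_le_of_le_one_right (Real.exp_pos _).le (hG1 _)
  -- the weights
  set V : ℤ → ℝ := fun k => if 0 ≤ k then (TE k.toNat).toReal else Real.exp (β * k) with hVdef
  have hVs : Summable V := by
    refine Summable.of_nat_of_neg_add_one ?_ ?_
    · refine hTs.congr fun m => ?_
      simp [hVdef]
    · refine hexps.congr fun m => ?_
      simp only [hVdef]
      rw [if_neg (by omega)]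
  have hers : ∀ i, Summable fun j : ℤ => Real.exp (β * j) * r i j := fun i =>
    Summable.of_nonneg_of_le (fun j => mul_nonneg (Real.exp_pos _).le (hr0 i j)) (hrD i) hDs
  have hens : Summable fun j : ℤ => Real.exp (β * j) * n' j :=
    Summable.of_nonneg_of_le (fun j => mul_nonneg (Real.exp_pos _).le (hn0 j)) hnD hDs
  set q : ℕ → ℝ := fun i => ∑' j : ℤ, Real.exp (β * j) * r i j with hq
  have hqeq : ∀ i, (∑' j : ℤ, ENNReal.ofReal (Real.exp (β * j)) * jumpP X i j).toReal = q i := by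
    intro i
    rw [ENNReal.tsum_toReal_eq (fun j => ENNReal.mul_ne_top ENNReal.ofReal_ne_top (hjtop i j))]
    refine tsum_congr fun j => ?_
    rw [ENNReal.toReal_mul, ENNReal.toReal_ofReal (Real.exp_pos _).le]
  simp_rw [hqeq] at hsum
  have hq1 : Tendsto q atTop (𝓝 1) := by
    have h1 := hsum.tendsto_atTop_zero
    have h2 := (tendsto_zero_iff_abs_tendsto_zero (fun i => q i - 1)).2 h1
    simpa using h2.add_const 1
  have hpsum : HasSum (fun j : ℤ => Real.exp (β * j) * n' j) 1 := by
    have h1 := hasSum_toReal0 (f := fun j : ℤ => ENNReal.ofReal (Real.exp (β * j)) * ν j)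
      (by rw [hcram]; exact ENNReal.one_ne_top)
    rw [hcram, ENNReal.toReal_one] at h1
    refine (hasSum_congr0 fun j => ?_).2 h1
    rw [ENNReal.toReal_mul, ENNReal.toReal_ofReal (Real.exp_pos _).le]
  have hnsum : HasSum n' 1 := by
    have h1 := hasSum_toReal0 (f := ν) (by rw [hν]; exact ENNReal.one_ne_top)
    rwa [hν, ENNReal.toReal_one] at h1
  -- sums over jumps versus sums over targets
  set p : ℕ → ℕ → ℝ := fun x y => (X.P x y).toReal with hp
  have hp0 : ∀ x y, 0 ≤ p x y := fun x y => ENNReal.toReal_nonneg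
  have hrp : ∀ x y : ℕ, r x ((y : ℤ) - x) = p x y := by
    intro x y
    simp only [hr, hp, jumpP]
    rw [if_pos (by omega)]
    congr 2
    omega
  have htrans : ∀ (x : ℕ) (f : ℤ → ℝ) (S : ℝ),
      HasSum (fun j => r x j * f j) S ↔ HasSum (fun y : ℕ => p x y * f ((y : ℤ) - x)) S := by
    intro x f S
    have hinj : Function.Injective (fun y : ℕ => (y : ℤ) - x) := fun u v h => by
      simp only at h; omega
    rw [← hinj.hasSum_iff]
    · refine hasSum_congr0 fun y => ?_
      simp only [Function.comp]
      rw [hrp]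
    · intro j hj
      have : ¬ (0 ≤ (x : ℤ) + j) := fun h => hj ⟨((x : ℤ) + j).toNat, by simp only; omega⟩
      simp [hr, jumpP, this]
  have hp1 : ∀ x, HasSum (p x) 1 := by
    intro x
    have h1 := hasSum_toReal0 (f := X.P x) (by rw [X.P_sum]; exact ENNReal.one_ne_top)
    rwa [X.P_sum, ENNReal.toReal_one] at h1
  have hr1 : ∀ x, HasSum (r x) 1 := by
    intro x
    have := (htrans x (fun _ => 1) 1).2 (by simpa using hp1 x)
    simpa using this
  set mm : ℤ → ℤ → ℝ := fun k j => min (Real.exp (β * j)) (Real.exp (β * k)) with hmm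
  have hmm0 : ∀ k j, 0 ≤ mm k j := fun k j => le_min (Real.exp_pos _).le (Real.exp_pos _).le
  have hrms : ∀ i k, Summable fun j => r i j * mm k j := fun i k =>
    Summable.of_nonneg_of_le (fun j => mul_nonneg (hr0 i j) (hmm0 k j))
      (fun j => by
        rw [mul_comm]
        exact mul_le_mul_of_nonneg_right (min_le_left _ _) (hr0 i j)) (hers i)
  have hnms : ∀ k, Summable fun j => n' j * mm k j := fun k =>
    Summable.of_nonneg_of_le (fun j => mul_nonneg (hn0 j) (hmm0 k j))
      (fun j => by
        rw [mul_comm]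
        exact mul_le_mul_of_nonneg_right (min_le_left _ _) (hn0 j)) hens
  set m : ℕ → ℤ → ℝ := fun i k => ∑' j, r i j * mm k j with hm
  set W : ℕ → ℤ → ℝ := fun i k => (if 0 ≤ k then q i else Real.exp (β * k)) - m i k with hW
  set Wi : ℤ → ℝ := fun k => (if 0 ≤ k then 1 else Real.exp (β * k)) - ∑' j, n' j * mm k j with hWi
  have hmlim : ∀ k, Tendsto (fun i => m i k) atTop (𝓝 (∑' j, n' j * mm k j)) := by
    intro k
    refine tendsto_tsum_of_dominated_convergence (bound := D) hDs
      (fun j => (hrn j).mul_const _) (Eventually.of_forall fun i j => ?_)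
    rw [Real.norm_eq_abs, abs_of_nonneg (mul_nonneg (hr0 i j) (hmm0 k j)), mul_comm]
    exact (mul_le_mul_of_nonneg_right (min_le_left _ _) (hr0 i j)).trans (hrD i j)
  have hWlim : ∀ k, Tendsto (fun i => W i k) atTop (𝓝 (Wi k)) := by
    intro k
    refine Tendsto.sub ?_ (hmlim k)
    split_ifs
    · exact hq1
    · exact tendsto_const_nhds
  have hm0 : ∀ i k, 0 ≤ m i k := fun i k => tsum_nonneg fun j => mul_nonneg (hr0 i j) (hmm0 k j)
  have hW0 : ∀ i k, 0 ≤ W i k := by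
    intro i k
    simp only [hW]
    rw [sub_nonneg]
    split_ifs
    · refine Summable.tsum_le_tsum (fun j => ?_) (hrms i k) (hers i)
      rw [mul_comm]
      exact mul_le_mul_of_nonneg_right (min_le_left _ _) (hr0 i j)
    · have h1 : HasSum (fun j => r i j * Real.exp (β * k)) (1 * Real.exp (β * k)) :=
        (hr1 i).mul_right _
      rw [one_mul] at h1
      exact hasSum_le (f := fun j => r i j * mm k j)
        (fun j => mul_le_mul_of_nonneg_left (min_le_right _ _) (hr0 i j)) (hrms i k).hasSum h1
  have hWV : ∀ i k, W i k ≤ V k := by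
    intro i k
    simp only [hW, hVdef]
    split_ifs with h
    · lift k to ℕ using h
      have h1 := (hers i).hasSum.sub (hrms i k).hasSum
      refine hasSum_le (f := fun j : ℤ => Real.exp (β * j) * r i j - r i j * mm k j)
        (fun j => ?_) h1 (hTD k)
      split_ifs with hkj
      · have := hrD i j
        have := mul_nonneg (hr0 i j) (hmm0 k j)
        linarith
      · have : mm k j = Real.exp (β * j) := by
          refine min_eq_left (Real.exp_le_exp.2 (mul_le_mul_of_nonneg_left ?_ hβ.le))
          exact_mod_cast not_lt.1 hkj
        rw [this]; linarith
    · linarith [hm0 i k]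
  -- existence of jumps of both signs
  have hneg : ∃ j < 0, 0 < n' j := by
    by_contra hc
    push Not at hc
    refine absurd hmean (not_lt.2 (tsum_nonneg fun j => ?_))
    rcases lt_or_ge j 0 with h | h
    · have : n' j = 0 := le_antisymm (hc j h) (hn0 j)
      simp only [hn'] at this
      simp [this]
    · exact mul_nonneg (by exact_mod_cast h) (hn0 j)
  have hpos : ∃ j > 0, 0 < n' j := by
    by_contra hc
    push Not at hc
    obtain ⟨j₀, hj₀, hnj₀⟩ := hneg
    have h1 : ∑' j : ℤ, Real.exp (β * j) * n' j < ∑' j, n' j := by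
      refine Summable.tsum_lt_tsum (i := j₀) (fun j => ?_) ?_ hens hnsum.summable
      · rcases lt_or_ge 0 j with h | h
        · have : n' j = 0 := le_antisymm (hc j h) (hn0 j)
          simp [this]
        · refine mul_le_of_le_one_left (hn0 j) (Real.exp_le_one_iff.2 ?_)
          exact mul_nonpos_of_nonneg_of_nonpos hβ.le (by exact_mod_cast h)
      · refine mul_lt_of_lt_one_left hnj₀ (Real.exp_lt_one_iff.2 ?_)
        exact mul_neg_of_pos_of_neg hβ (by exact_mod_cast hj₀)
    rw [hpsum.tsum_eq, hnsum.tsum_eq] at h1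
    exact lt_irrefl _ h1
  have hW00 : 0 < Wi 0 := by
    obtain ⟨j₀, hj₀, hnj₀⟩ := hpos
    simp only [hWi, le_refl, if_true]
    rw [sub_pos, ← hpsum.tsum_eq]
    refine Summable.tsum_lt_tsum (i := j₀) (fun j => ?_) ?_ (hnms 0) hens
    · rw [mul_comm]
      exact mul_le_mul_of_nonneg_right (min_le_left _ _) (hn0 j)
    · rw [mul_comm]
      refine mul_lt_mul_of_pos_right (lt_of_le_of_lt (min_le_right _ _) (Real.exp_lt_exp.2 ?_)) hnj₀
      exact mul_lt_mul_of_pos_left (by exact_mod_cast hj₀) hβ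
  -- the transformed measure
  set a : ℤ → ℝ := fun i => if 0 ≤ i then π i.toNat * Real.exp (β * i) else 0 with ha
  have han : ∀ x : ℕ, a x = π x * Real.exp (β * x) := fun x => by simp [ha]
  have ha0 : ∀ i < 0, a i = 0 := fun i hi => if_neg (by omega)
  have hapos : ∀ i, 0 ≤ i → 0 < a i := fun i hi => by
    simp only [ha]; rw [if_pos hi]; exact mul_pos (hπpos _) (Real.exp_pos _)
  have htoNat : Tendsto Int.toNat atTop atTop := by
    refine tendsto_atTop.2 fun b => ?_
    filter_upwards [eventually_ge_atTop (b : ℤ)] with i hi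
    omega
  have hflip : ∀ (n : ℕ) (f : ℤ → ℝ) (S : ℝ), (∀ k, (n : ℤ) - k < 0 → f k = 0) →
      (HasSum (fun x : ℕ => f ((n : ℤ) - x)) S ↔ HasSum f S) := by
    intro n f S hf
    have hinj : Function.Injective (fun y : ℕ => (n : ℤ) - y) := fun u v h => by
      simp only at h; omega
    refine hinj.hasSum_iff (f := f) fun k hk => hf k ?_
    by_contra h
    exact hk ⟨((n : ℤ) - k).toNat, by simp only; omega⟩
  have hfin := lemC a ha0 hapos (fun i j => Real.exp (β * j) * r i.toNat j)
    (fun j => Real.exp (β * j) * n' j) D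
    (fun i j => mul_nonneg (Real.exp_pos _).le (hr0 _ _)) (fun i j => hrD _ _) hDs
    (fun j => ((hrn j).comp htoNat).const_mul _) hpsum ?_ ?_ (fun i k => W i.toNat k) V Wi
    (fun i k => hW0 _ _) (fun i k => hWV _ _) hVs (fun k => (hWlim k).comp htoNat) hW00
    (fun x => q x - 1) hsum ?_
  · obtain ⟨c, hc, hlim⟩ := hfin
    exact ⟨c, hc, hlim.congr fun x => han x⟩
  · intro i hi
    lift i to ℕ using hi
    refine (HasSum.tsum_eq ?_).symm
    refine (hflip i _ _ fun k hk => ?_).1 ?_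
    · rw [ha0 _ hk, mul_zero]
    · rw [han]
      refine (hasSum_congr0 fun x => ?_).1 ((hπinv i).mul_right (Real.exp (β * i)))
      rw [sub_sub_cancel, han, Int.toNat_natCast, hrp]
      have : Real.exp (β * i) = Real.exp (β * (((i : ℤ) - x : ℤ) : ℝ)) * Real.exp (β * x) := by
        rw [← Real.exp_add]; congr 1; push_cast; ring
      rw [this]; simp only [hp]; ring
  · intro d hd
    obtain ⟨j₁, j₂, h1, h2, h3⟩ := hlattice d hd
    refine ⟨j₁, j₂, ?_, ?_, h3⟩
    · exact mul_ne_zero (Real.exp_pos _).ne' (ENNReal.toReal_ne_zero.2 ⟨h1, hνtop _⟩)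
    · exact mul_ne_zero (Real.exp_pos _).ne' (ENNReal.toReal_ne_zero.2 ⟨h2, hνtop _⟩)
  · intro n
    refine (hflip n _ _ fun k hk => ?_).1 ?_
    · rw [ha0 _ hk, zero_mul]
    · have h1 := lemF π hπpos hπsum p hp0 hp1 hπinv
        (fun y => min (Real.exp (β * y)) (Real.exp (β * n))) (Real.exp (β * n))
        (fun y => le_min (Real.exp_pos _).le (Real.exp_pos _).le) (fun y => min_le_right _ _)
      have h2 : HasSum (fun x : ℕ => if x ≤ n then a x * (q x - 1) else 0)
          (∑ x ∈ Finset.range (n + 1), a x * (q x - 1)) := by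
        have h3 := hasSum_sum_of_ne_finset_zero (L := .unconditional ℕ)
          (f := fun x : ℕ => if x ≤ n then a x * (q x - 1) else 0)
          (s := Finset.range (n + 1)) (fun x hx => by
            rw [Finset.mem_range] at hx; exact if_neg (by omega))
        convert h3 using 1
        refine Finset.sum_congr rfl fun x hx => ?_
        rw [Finset.mem_range] at hx; rw [if_pos (by omega)]
      have h3 := h2.sub h1
      rw [sub_zero] at h3
      refine (hasSum_congr0 fun x => ?_).1 h3
      rw [sub_sub_cancel, Int.toNat_natCast]
      have hscale : ∀ y : ℤ, Real.exp (β * y) = Real.exp (β * x) * Real.exp (β * ((y - x : ℤ) : ℝ)) := by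
        intro y; rw [← Real.exp_add]; congr 1; push_cast; ring
      have h4 : ∑' y : ℕ, p x y * min (Real.exp (β * y)) (Real.exp (β * n)) =
          Real.exp (β * x) * m x ((n : ℤ) - x) := by
        have h5 := (htrans x (mm ((n : ℤ) - x)) _).1 (hrms x ((n : ℤ) - x)).hasSum
        refine HasSum.tsum_eq ?_
        refine (hasSum_congr0 fun y => ?_).1 (h5.mul_left (Real.exp (β * x)))
        have e1 := hscale y
        have e2 := hscale n
        simp only [Int.cast_natCast] at e1 e2
        rw [e1, e2, ← mul_min_of_nonneg _ _ (Real.exp_pos _).le]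
        simp only [hmm]; ring
      rw [h4]
      have e2 := hscale n
      simp only [Int.cast_natCast] at e2
      simp only [hW]
      rw [han]
      by_cases hx : x ≤ n
      · rw [if_pos hx, if_pos (by omega), min_eq_left]
        · ring
        · exact Real.exp_le_exp.2 (mul_le_mul_of_nonneg_left (by exact_mod_cast hx) hβ.le)
      · rw [if_neg hx, if_neg (by omega), min_eq_right, e2]
        · ring
        · exact Real.exp_le_exp.2 (mul_le_mul_of_nonneg_left (by exact_mod_cast (not_le.1 hx).le) hβ.le)
end
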